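/- arXiv:2107.13092 — 7 statements merged into one kernel-verified Lean document; each statement's English description precedes it below -/
import Mathlib

section
/- Let R be a commutative ring and let A be a 2 × 2 matrix over R. Then for every positive integer m, A₁₂ · (Aᵐ)₂₁ = A₂₁ · (Aᵐ)₁₂, i.e. the product of the (1,2) entry of A with the (2,1) entry of Aᵐ equals the product of the (2,1) entry of A with the (1,2) entry of Aᵐ. -/
theorem larcombe_two_by_two {R : Type*} [CommRing R]
    (A : Matrix (Fin 2) (Fin 2) R) (m : ℕ) (hm : 0 < m) :
    A 0 1 * (A ^ m) 1 0 = A 1 0 * (A ^ m) 0 1 := by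
  have h := congrFun (congrFun ((Commute.refl A).pow_right m).eq 0) 0
  rw [Matrix.mul_apply, Matrix.mul_apply, Fin.sum_univ_two, Fin.sum_univ_two] at h
  linear_combination h
end

section
/- Let n ≥ 1 and let A be the generic n × n matrix whose (i,j) entry is the indeterminate x_{ij} in the polynomial ring ℤ[x_{ij} : 1 ≤ i,j ≤ n]. For every subset S of {(i,j) : 1 ≤ i,j ≤ n} of cardinality n+1, there exist polynomials q_s ∈ ℤ[x_{ij}] for s ∈ S, not all zero, such that for every positive integer m, ∑_{s ∈ S} q_s · (Aᵐ)_s = 0, where (Aᵐ)_s denotes the entry of Aᵐ in position s. -/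
/-- A linear functional vanishing on the powers of a square matrix with exponent less than the
size of the matrix vanishes on all powers. -/
theorem LinearMap.matrix_pow_eq_zero_of_lt_card {R ι M : Type*} [CommRing R] [Nontrivial R]
    [Fintype ι] [DecidableEq ι] [AddCommGroup M] [Module R M] (f : Matrix ι ι R →ₗ[R] M)
    (A : Matrix ι ι R) (h : ∀ k < Fintype.card ι, f (A ^ k) = 0) (m : ℕ) : f (A ^ m) = 0 := by
  have hdeg : (Polynomial.X ^ m %ₘ A.charpoly).degree < (Fintype.card ι : ℕ) := by
    simpa only [A.charpoly_degree_eq_dim] using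
      Polynomial.degree_modByMonic_lt (Polynomial.X ^ m) A.charpoly_monic
  rw [A.pow_eq_aeval_mod_charpoly, Polynomial.aeval_def, Polynomial.eval₂_eq_sum,
    Polynomial.sum_def, map_sum]
  refine Finset.sum_eq_zero fun k hk => ?_
  have hk' : k < Fintype.card ι := by
    exact_mod_cast (Polynomial.le_degree_of_mem_supp k hk).trans_lt hdeg
  rw [← Algebra.smul_def, map_smul, h k hk', smul_zero]

/-- Any `n + 1` entry positions of an `n × n` matrix over a nontrivial commutative ring satisfy a
nontrivial linear relation that holds simultaneously for all powers of the matrix. -/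
theorem Matrix.exists_sum_mul_pow_apply_eq_zero {R ι : Type*} [CommRing R] [Nontrivial R]
    [Fintype ι] [DecidableEq ι] (A : Matrix ι ι R) (S : Finset (ι × ι))
    (hS : Fintype.card ι < S.card) :
    ∃ q : ι × ι → R, (∃ s ∈ S, q s ≠ 0) ∧
      ∀ m : ℕ, ∑ s ∈ S, q s * (A ^ m) s.1 s.2 = 0 := by
  have hdep : ¬ LinearIndepOn R
      (fun (s : ι × ι) (k : Fin (Fintype.card ι)) => (A ^ (k : ℕ)) s.1 s.2) (S : Set (ι × ι)) := by
    intro hli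
    have hle := LinearIndependent.fintype_card_le_finrank hli
    simp at hle
    omega
  rw [linearIndepOn_finset_iff] at hdep
  push Not at hdep
  obtain ⟨q, hq, hne⟩ := hdep
  refine ⟨q, hne, fun m => ?_⟩
  let f : Matrix ι ι R →ₗ[R] R := ∑ s ∈ S, q s • Matrix.entryLinearMap R R s.1 s.2
  have hf (M : Matrix ι ι R) : f M = ∑ s ∈ S, q s * M s.1 s.2 := by
    simp [f]
  rw [← hf]
  refine f.matrix_pow_eq_zero_of_lt_card A (fun k hk => ?_) m
  simpa [hf] using congrFun hq ⟨k, hk⟩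


open MvPolynomial in
theorem generic_matrix_power_entries_dependent (n : ℕ) (hn : 1 ≤ n)
    (A : Matrix (Fin n) (Fin n) (MvPolynomial (Fin n × Fin n) ℤ))
    (hA : ∀ i j, A i j = X (i, j))
    (S : Finset (Fin n × Fin n)) (hS : S.card = n + 1) :
    ∃ q : Fin n × Fin n → MvPolynomial (Fin n × Fin n) ℤ,
      (∃ s ∈ S, q s ≠ 0) ∧
      ∀ m : ℕ, 0 < m → ∑ s ∈ S, q s * (A ^ m) s.1 s.2 = 0 := by
  obtain ⟨q, hne, hq⟩ := A.exists_sum_mul_pow_apply_eq_zero S (by simp [hS])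
  exact ⟨q, hne, fun m _ => hq m⟩
end

section
/- Let n ≥ 2 and let A be the generic n × n matrix whose (i,j) entry is the indeterminate x_{ij} in the polynomial ring ℤ[x_{ij} : 1 ≤ i,j ≤ n]. For every subset S of the non-diagonal positions {(i,j) : 1 ≤ i,j ≤ n, i ≠ j} of cardinality n, there exist polynomials q_s ∈ ℤ[x_{ij}] for s ∈ S, not all zero, such that for every positive integer m, ∑_{s ∈ S} q_s · (Aᵐ)_s = 0. -/
/-- A linear form in the entries of a matrix that vanishes on its powers of exponent less than
the size of the matrix vanishes on all its powers. -/
theorem Matrix.map_pow_eq_zero_of_forall_lt {R M : Type*} [CommRing R] [Nontrivial R]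
    [AddCommGroup M] [Module R M] {n : ℕ} (A : Matrix (Fin n) (Fin n) R)
    (L : Matrix (Fin n) (Fin n) R →ₗ[R] M) (hL : ∀ k < n, L (A ^ k) = 0) (m : ℕ) :
    L (A ^ m) = 0 := by
  rcases Nat.eq_zero_or_pos n with rfl | hn
  · rw [Subsingleton.elim (A ^ m) 0, map_zero]
  have hdeg : (Polynomial.X ^ m %ₘ A.charpoly).natDegree < n := by
    have h := Polynomial.natDegree_modByMonic_lt (Polynomial.X ^ m) A.charpoly_monic
      (fun h => by simpa [h, hn.ne] using A.charpoly_natDegree_eq_dim)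
    rwa [A.charpoly_natDegree_eq_dim, Fintype.card_fin] at h
  rw [A.pow_eq_aeval_mod_charpoly m, Polynomial.aeval_eq_sum_range' hdeg, map_sum]
  refine Finset.sum_eq_zero fun k hk => ?_
  rw [map_smul, hL k (Finset.mem_range.1 hk), smul_zero]

/-- Over an integral domain, any `n` off-diagonal positions of an `n × n` matrix satisfy a
nontrivial linear relation that holds for all powers of the matrix. -/
theorem Matrix.exists_offDiag_relation_pow {R : Type*} [CommRing R] [IsDomain R] {n : ℕ}
    (hn : 0 < n) (A : Matrix (Fin n) (Fin n) R) (S : Finset (Fin n × Fin n)) (hS : S.card = n)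
    (hoff : ∀ s ∈ S, s.1 ≠ s.2) :
    ∃ q : Fin n × Fin n → R, (∃ s ∈ S, q s ≠ 0) ∧
      ∀ m : ℕ, ∑ s ∈ S, q s * (A ^ m) s.1 s.2 = 0 := by
  classical
  let e := S.equivFinOfCardEq hS
  let M : Matrix S S R := fun t s => (A ^ (e t : ℕ)) s.1.1 s.1.2
  have hdet : M.det = 0 := by
    refine Matrix.det_eq_zero_of_row_eq_zero (e.symm ⟨0, hn⟩) fun s => ?_
    simp [M, Matrix.one_apply_ne (hoff s.1 s.2)]
  obtain ⟨v, hv, hMv⟩ := Matrix.exists_mulVec_eq_zero_iff.2 hdet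
  obtain ⟨s, hs⟩ := Function.ne_iff.1 hv
  let q : Fin n × Fin n → R := fun t => if h : t ∈ S then v ⟨t, h⟩ else 0
  have hq (t : S) : q t = v t := by simp [q]
  refine ⟨q, ⟨s, s.2, by simpa [hq] using hs⟩, fun m => ?_⟩
  let L : Matrix (Fin n) (Fin n) R →ₗ[R] R :=
    ∑ t ∈ S, q t • Matrix.entryLinearMap R R t.1 t.2
  have hL (B : Matrix (Fin n) (Fin n) R) : L B = ∑ t ∈ S, q t * B t.1 t.2 := by
    simp [L, LinearMap.sum_apply]
  rw [← hL]
  refine A.map_pow_eq_zero_of_forall_lt L (fun k hk => ?_) m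
  have h := congrFun hMv (e.symm ⟨k, hk⟩)
  rw [hL, ← Finset.sum_coe_sort]
  simpa [M, Matrix.mulVec, dotProduct, hq, mul_comm] using h

open MvPolynomial in
theorem generic_matrix_power_offdiag_entries_dependent (n : ℕ) (hn : 2 ≤ n)
    (A : Matrix (Fin n) (Fin n) (MvPolynomial (Fin n × Fin n) ℤ))
    (hA : ∀ i j, A i j = X (i, j))
    (S : Finset (Fin n × Fin n)) (hS : S.card = n)
    (hoff : ∀ s ∈ S, s.1 ≠ s.2) :
    ∃ q : Fin n × Fin n → MvPolynomial (Fin n × Fin n) ℤ,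
      (∃ s ∈ S, q s ≠ 0) ∧
      ∀ m : ℕ, 0 < m → ∑ s ∈ S, q s * (A ^ m) s.1 s.2 = 0 := by
  obtain ⟨q, hq, h⟩ := A.exists_offDiag_relation_pow (by lia) S hS hoff
  exact ⟨q, hq, fun m _ => h m⟩
end

section
/- Let R be a commutative ring and A = (a_{ij}) a 3 × 3 matrix over R. Then for every positive integer m: (a₁₂a₂₁a₂₃ − a₁₃a₂₁a₂₂ + a₁₃a₂₁a₃₃ − a₁₃a₂₃a₃₁) · (Aᵐ)₁₂ + (a₁₂a₂₃a₃₁ − a₁₃a₂₁a₃₂) · (Aᵐ)₁₃ + (−a₁₂²a₂₃ + a₁₂a₁₃a₂₂ − a₁₂a₁₃a₃₃ + a₁₃²a₃₂) · (Aᵐ)₂₁ = 0. -/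
/-- The Cayley-Hamilton identity for `3 × 3` matrices, with explicit coefficients. -/
theorem Matrix.pow_three_fin_three {R : Type*} [CommRing R] (A : Matrix (Fin 3) (Fin 3) R) :
    A ^ 3 = (A 0 0 + A 1 1 + A 2 2) • A ^ 2
      - (A 0 0 * A 1 1 - A 0 1 * A 1 0 + A 0 0 * A 2 2 - A 0 2 * A 2 0
        + A 1 1 * A 2 2 - A 1 2 * A 2 1) • A + A.det • (1 : Matrix (Fin 3) (Fin 3) R) := by
  ext i j
  fin_cases i <;> fin_cases j <;>
    simp [pow_succ, Matrix.mul_apply, Fin.sum_univ_three, Matrix.det_fin_three] <;> ring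

/-- Every power of a `3 × 3` matrix is a linear combination of `1`, `A` and `A ^ 2`. -/
theorem Matrix.exists_pow_eq_fin_three {R : Type*} [CommRing R]
    (A : Matrix (Fin 3) (Fin 3) R) (m : ℕ) :
    ∃ x y z : R, A ^ m = x • (1 : Matrix (Fin 3) (Fin 3) R) + y • A + z • A ^ 2 := by
  induction m with
  | zero => exact ⟨1, 0, 0, by simp⟩
  | succ k ih =>
    obtain ⟨x, y, z, h⟩ := ih
    refine ⟨z * A.det, x - z * (A 0 0 * A 1 1 - A 0 1 * A 1 0 + A 0 0 * A 2 2 - A 0 2 * A 2 0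
      + A 1 1 * A 2 2 - A 1 2 * A 2 1), y + z * (A 0 0 + A 1 1 + A 2 2), ?_⟩
    rw [pow_succ, h, add_mul, add_mul, smul_mul_assoc, smul_mul_assoc, smul_mul_assoc,
      ← pow_succ, ← sq, one_mul, A.pow_three_fin_three]
    module

theorem three_by_three_relation {R : Type*} [CommRing R]
    (A : Matrix (Fin 3) (Fin 3) R) (m : ℕ) (hm : 0 < m) :
    (A 0 1 * A 1 0 * A 1 2 - A 0 2 * A 1 0 * A 1 1 + A 0 2 * A 1 0 * A 2 2
        - A 0 2 * A 1 2 * A 2 0) * (A ^ m) 0 1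
      + (A 0 1 * A 1 2 * A 2 0 - A 0 2 * A 1 0 * A 2 1) * (A ^ m) 0 2
      + (-(A 0 1 ^ 2 * A 1 2) + A 0 1 * A 0 2 * A 1 1 - A 0 1 * A 0 2 * A 2 2
        + A 0 2 ^ 2 * A 2 1) * (A ^ m) 1 0 = 0 := by
  obtain ⟨x, y, z, h⟩ := A.exists_pow_eq_fin_three m
  rw [h]
  simp only [Matrix.add_apply, Matrix.smul_apply, smul_eq_mul, sq A, Matrix.mul_apply,
    Fin.sum_univ_three, Matrix.one_apply_ne (show (0 : Fin 3) ≠ 1 by decide),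
    Matrix.one_apply_ne (show (0 : Fin 3) ≠ 2 by decide),
    Matrix.one_apply_ne (show (1 : Fin 3) ≠ 0 by decide)]
  ring
end

section
/- (Larcombe–Fennessey) Let R be a commutative ring, n ≥ 2, and let A be an n × n tridiagonal matrix over R, i.e. a_{ij} = 0 whenever |i − j| ≥ 2. Then for every index i with 1 ≤ i < n and every positive integer m, a_{i,i+1} · (Aᵐ)_{i+1,i} = a_{i+1,i} · (Aᵐ)_{i,i+1}. -/
open Finset in
/-- If `A` and `B` commute, the flows `A k l * B l k` and `B k l * A l k` out of any set of indices
have the same total. -/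
lemma Commute.sum_mul_compl_eq {R ι : Type*} [CommRing R] [Fintype ι] [DecidableEq ι]
    {A B : Matrix ι ι R} (h : Commute A B) (s : Finset ι) :
    ∑ k ∈ s, ∑ l ∈ sᶜ, A k l * B l k = ∑ k ∈ s, ∑ l ∈ sᶜ, B k l * A l k := by
  have hdiag : ∑ k ∈ s, ∑ l, A k l * B l k = ∑ k ∈ s, ∑ l, B k l * A l k :=
    sum_congr rfl fun k _ => by simpa only [Matrix.mul_apply] using congr_fun₂ h.eq k k
  have hswap : ∑ k ∈ s, ∑ l ∈ s, A k l * B l k = ∑ k ∈ s, ∑ l ∈ s, B k l * A l k := by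
    rw [sum_comm]
    simp only [mul_comm]
  simp only [← sum_add_sum_compl s, sum_add_distrib] at hdiag
  rw [hswap] at hdiag
  exact add_left_cancel hdiag

open Finset in
lemma Fin.sum_Iic_sum_compl_eq_single {M : Type*} [AddCommMonoid M] {n : ℕ}
    (f : Fin n → Fin n → M) (hf : ∀ k l : Fin n, (k : ℕ) + 2 ≤ l → f k l = 0)
    {i j : Fin n} (hij : (j : ℕ) = (i : ℕ) + 1) :
    ∑ k ∈ Iic i, ∑ l ∈ (Iic i)ᶜ, f k l = f i j := by
  rw [sum_eq_single i, sum_eq_single j]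
  · intro l hl hlj
    simp only [mem_compl, mem_Iic, Fin.le_def] at hl
    exact hf _ _ (by have := Fin.val_ne_of_ne hlj; omega)
  · intro hj
    simp only [mem_compl, mem_Iic, Fin.le_def] at hj
    omega
  · intro k hk hki
    refine sum_eq_zero fun l hl => ?_
    simp only [mem_compl, mem_Iic, Fin.le_def] at hk hl
    exact hf _ _ (by have := Fin.val_ne_of_ne hki; omega)
  · intro hi
    simp at hi

theorem larcombe_fennessey_tridiagonal {R : Type*} [CommRing R] {n : ℕ} (hn : 2 ≤ n)
    (A : Matrix (Fin n) (Fin n) R)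
    (htri : ∀ i j : Fin n, 2 ≤ |(i : ℤ) - (j : ℤ)| → A i j = 0)
    (i j : Fin n) (hij : (j : ℕ) = (i : ℕ) + 1)
    (m : ℕ) (hm : 0 < m) :
    A i j * (A ^ m) j i = A j i * (A ^ m) i j := by
  have hupper (k l : Fin n) (h : (k : ℕ) + 2 ≤ l) : A k l = 0 :=
    htri k l (by rw [le_abs]; omega)
  have hlower (k l : Fin n) (h : (k : ℕ) + 2 ≤ l) : A l k = 0 :=
    htri l k (by rw [le_abs]; omega)
  have hflow := (Commute.self_pow A m).sum_mul_compl_eq (Finset.Iic i)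
  rw [Fin.sum_Iic_sum_compl_eq_single (fun k l => A k l * (A ^ m) l k)
      (fun k l h => by simp [hupper k l h]) hij,
    Fin.sum_Iic_sum_compl_eq_single (fun k l => (A ^ m) k l * A l k)
      (fun k l h => by simp [hlower k l h]) hij] at hflow
  rw [hflow, mul_comm]
end

section
/- Let R be a commutative ring, A an n × n matrix over R with n ≥ 1, S a set of positions (i,j) with 1 ≤ i,j ≤ n, and q_s ∈ R for each s ∈ S. If ∑_{s ∈ S} q_s · (Aᵐ)_s = 0 holds for each m = 1, 2, …, n, then it holds for every positive integer m. -/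
/-- **Cayley–Hamilton** solved for the top power. -/
theorem Matrix.pow_card_eq_neg_sum {R ι : Type*} [CommRing R] [Fintype ι] [DecidableEq ι]
    (A : Matrix ι ι R) :
    A ^ Fintype.card ι = -∑ i ∈ Finset.range (Fintype.card ι), A.charpoly.coeff i • A ^ i := by
  nontriviality R
  have hA := A.aeval_self_charpoly
  have hlead : A.charpoly.coeff (Fintype.card ι) = 1 := by
    simpa [Polynomial.Monic, Polynomial.leadingCoeff] using A.charpoly_monic
  rw [Polynomial.aeval_eq_sum_range, A.charpoly_natDegree_eq_dim, Finset.sum_range_succ,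
    hlead, one_smul] at hA
  exact eq_neg_of_add_eq_zero_right hA

/-- A linear map that vanishes on the first `card ι` positive powers of a square matrix vanishes on
all its positive powers. -/
theorem Matrix.map_pow_eq_zero_of_le_card {R ι M : Type*} [CommRing R] [Fintype ι] [DecidableEq ι]
    [AddCommGroup M] [Module R M] (A : Matrix ι ι R) (f : Matrix ι ι R →ₗ[R] M)
    (h : ∀ m, 1 ≤ m → m ≤ Fintype.card ι → f (A ^ m) = 0) (m : ℕ) (hm : 0 < m) :
    f (A ^ m) = 0 := by
  induction m using Nat.strong_induction_on with
  | _ m ih =>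
    rcases le_or_gt m (Fintype.card ι) with hle | hlt
    · exact h m hm hle
    · obtain ⟨k, rfl⟩ := Nat.exists_eq_add_of_lt hlt
      rw [add_assoc, add_comm, pow_add, A.pow_card_eq_neg_sum, mul_neg, map_neg, Finset.mul_sum,
        map_sum, neg_eq_zero]
      refine Finset.sum_eq_zero fun i hi => ?_
      rw [Finset.mem_range] at hi
      rw [mul_smul_comm, ← pow_add, map_smul, ih _ (by lia) (by lia), smul_zero]

theorem relation_from_first_n_powers {R : Type*} [CommRing R] {n : ℕ} (hn : 1 ≤ n)
    (A : Matrix (Fin n) (Fin n) R)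
    (S : Finset (Fin n × Fin n)) (q : Fin n × Fin n → R)
    (h : ∀ m : ℕ, 1 ≤ m → m ≤ n → ∑ s ∈ S, q s * (A ^ m) s.1 s.2 = 0) :
    ∀ m : ℕ, 0 < m → ∑ s ∈ S, q s * (A ^ m) s.1 s.2 = 0 := by
  let f : Matrix (Fin n) (Fin n) R →ₗ[R] R := ∑ s ∈ S, q s • Matrix.entryLinearMap R R s.1 s.2
  have hf (B : Matrix (Fin n) (Fin n) R) : f B = ∑ s ∈ S, q s * B s.1 s.2 := by
    simp [f, LinearMap.sum_apply]
  simpa only [hf] using A.map_pow_eq_zero_of_le_card f (by simpa only [hf, Fintype.card_fin] using h)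
end

section
/- Fix n ≥ 2, an index i with 1 ≤ i < n, and a positive integer m. Let S₁ be the set of continuous words w₁w₂…w_{m+2} in the alphabet {1,…,n} with w₁ = i, w₂ = i+1 and w_{m+2} = i, and let S₂ be the set of continuous words w₁w₂…w_{m+2} with w₁ = i+1, w₂ = i and w_{m+2} = i+1. Then there exists a bijection T : S₁ → S₂ that preserves weights, where the weight of a word w is the monomial ∏_{k=1}^{m+1} x_{w_k, w_{k+1}} in the polynomial ring ℤ[x_{ij} : 1 ≤ i,j ≤ n]. -/
/-- For a walk `v` on `ℕ` with steps of size at most one, replacing each step by its reverse changes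
the product of the step weights only by the weights of the edges between the two endpoints. -/
theorem prod_walk_mul_eq_prod_reverse_mul {R : Type*} [CommMonoid R] (g : ℕ → ℕ → R) (N : ℕ)
    (v : Fin (N + 1) → ℕ)
    (hv : ∀ k : Fin N, |(v k.succ : ℤ) - (v k.castSucc : ℤ)| ≤ 1) :
    (∏ k : Fin N, g (v k.castSucc) (v k.succ)) *
        ((∏ j ∈ Finset.range (v 0), g j (j + 1)) *
          ∏ j ∈ Finset.range (v (Fin.last N)), g (j + 1) j) =
      (∏ k : Fin N, g (v k.succ) (v k.castSucc)) *
        ((∏ j ∈ Finset.range (v (Fin.last N)), g j (j + 1)) *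
          ∏ j ∈ Finset.range (v 0), g (j + 1) j) := by
  induction N with
  | zero => simp
  | succ N ih =>
    have h := ih (fun k => v k.castSucc) (fun k => by simpa using hv k.castSucc)
    have hstep := hv (Fin.last N)
    simp only [Fin.castSucc_zero, Fin.succ_last] at h hstep
    rw [Fin.prod_univ_castSucc, Fin.prod_univ_castSucc]
    simp only [Fin.succ_last, Fin.succ_castSucc]
    generalize v (Fin.last N).castSucc = a at *
    generalize v (Fin.last (N + 1)) = b at *
    generalize (∏ k : Fin N, g (v k.castSucc.castSucc) (v k.succ.castSucc)) = A at *
    generalize (∏ k : Fin N, g (v k.succ.castSucc) (v k.castSucc.castSucc)) = B at *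
    generalize (∏ j ∈ Finset.range (v 0), g j (j + 1)) = U at *
    generalize (∏ j ∈ Finset.range (v 0), g (j + 1) j) = D at *
    rw [abs_le] at hstep
    obtain hb | hb | hb : b = a ∨ b = a + 1 ∨ a = b + 1 := by omega
    · subst hb
      rw [mul_right_comm, h, mul_right_comm]
    · subst hb
      rw [Finset.prod_range_succ, Finset.prod_range_succ]
      calc _ = A * (U * ∏ j ∈ Finset.range a, g (j + 1) j) * (g a (a + 1) * g (a + 1) a) := by
            ac_rfl
        _ = _ := by rw [h]; ac_rfl
    · subst hb
      rw [Finset.prod_range_succ, Finset.prod_range_succ] at h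
      calc _ = A * (U * ((∏ j ∈ Finset.range b, g (j + 1) j) * g (b + 1) b)) := by ac_rfl
        _ = _ := by rw [h]; ac_rfl

/-- A closed walk on `ℕ` with steps of size at most one has the same weight as its reverse. -/
theorem prod_closed_walk_eq_prod_reverse {R : Type*} [CommMonoidWithZero R] [NoZeroDivisors R]
    [Nontrivial R] [IsCancelMulZero R] (g : ℕ → ℕ → R) (hg : ∀ a b, g a b ≠ 0) (N : ℕ)
    (v : Fin (N + 1) → ℕ)
    (hv : ∀ k : Fin N, |(v k.succ : ℤ) - (v k.castSucc : ℤ)| ≤ 1) (hclosed : v 0 = v (Fin.last N)) :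
    ∏ k : Fin N, g (v k.castSucc) (v k.succ) = ∏ k : Fin N, g (v k.succ) (v k.castSucc) := by
  have h := prod_walk_mul_eq_prod_reverse_mul g N v hv
  rw [← hclosed] at h
  exact mul_right_cancel₀ (mul_ne_zero (Finset.prod_ne_zero_iff.2 fun _ _ => hg _ _)
    (Finset.prod_ne_zero_iff.2 fun _ _ => hg _ _)) h

/-- The word `w₁ w_{m+1} w_m ⋯ w₁` obtained from `w₀ w₁ ⋯ w_{m+1}`: for a closed walk this is its
reversal, started one step later. -/
def reverseRotate {α : Type*} {m : ℕ} (w : Fin (m + 2) → α) : Fin (m + 2) → α :=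
  Fin.cons (w 1) fun k : Fin (m + 1) => w k.rev.succ

theorem reverseRotate_zero {α : Type*} {m : ℕ} (w : Fin (m + 2) → α) :
    reverseRotate w 0 = w 1 := rfl

theorem reverseRotate_succ {α : Type*} {m : ℕ} (w : Fin (m + 2) → α) (k : Fin (m + 1)) :
    reverseRotate w k.succ = w k.rev.succ := rfl

theorem reverseRotate_one {α : Type*} {m : ℕ} (w : Fin (m + 2) → α) :
    reverseRotate w 1 = w (Fin.last (m + 1)) := by
  rw [← Fin.succ_zero_eq_one, reverseRotate_succ, Fin.rev_zero, Fin.succ_last]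

theorem reverseRotate_last {α : Type*} {m : ℕ} (w : Fin (m + 2) → α) :
    reverseRotate w (Fin.last (m + 1)) = w 1 := by
  rw [← Fin.succ_last, reverseRotate_succ, Fin.rev_last, Fin.succ_zero_eq_one]

theorem reverseRotate_reverseRotate {α : Type*} {m : ℕ} (w : Fin (m + 2) → α)
    (hw : w 0 = w (Fin.last (m + 1))) : reverseRotate (reverseRotate w) = w := by
  funext k
  refine Fin.cases ?_ (fun k => ?_) k
  · rw [reverseRotate_zero, reverseRotate_one, hw]
  · rw [reverseRotate_succ, reverseRotate_succ, Fin.rev_rev]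

/-- The steps of `reverseRotate w` are those of the closed walk `w`, reversed. -/
theorem prod_reverseRotate {α R : Type*} [CommMonoid R] {m : ℕ} (g : α → α → R)
    (w : Fin (m + 2) → α) (hw : w 0 = w (Fin.last (m + 1))) :
    ∏ k : Fin (m + 1), g (reverseRotate w k.castSucc) (reverseRotate w k.succ) =
      ∏ k : Fin (m + 1), g (w k.succ) (w k.castSucc) := by
  rw [Fin.prod_univ_succ, Fin.prod_univ_succ]
  congr 1
  · rw [Fin.castSucc_zero, Fin.succ_zero_eq_one, reverseRotate_zero, reverseRotate_one, hw]
  · refine Fintype.prod_equiv Fin.revPerm _ _ fun k => ?_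
    simp only [← Fin.succ_castSucc, reverseRotate_succ, Fin.rev_castSucc, Fin.rev_succ,
      Fin.revPerm_apply]

theorem abs_step_reverseRotate_le_one {n m : ℕ} (w : Fin (m + 2) → Fin n)
    (hw : w 0 = w (Fin.last (m + 1)))
    (h : ∀ k : Fin (m + 1), |(w k.succ : ℤ) - (w k.castSucc : ℤ)| ≤ 1) (k : Fin (m + 1)) :
    |((reverseRotate w k.succ : Fin n) : ℤ) - ((reverseRotate w k.castSucc : Fin n) : ℤ)| ≤ 1 := by
  refine Fin.cases ?_ (fun k => ?_) k
  · have h0 := h 0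
    rw [Fin.castSucc_zero, Fin.succ_zero_eq_one] at *
    rwa [reverseRotate_zero, reverseRotate_one, ← hw, abs_sub_comm]
  · have hk := h k.rev.succ
    rw [← Fin.succ_castSucc] at *
    rwa [reverseRotate_succ, reverseRotate_succ, Fin.rev_castSucc, Fin.rev_succ, abs_sub_comm]

open MvPolynomial in
theorem prod_X_reverseRotate {n m : ℕ} (w : Fin (m + 2) → Fin n)
    (hw : w 0 = w (Fin.last (m + 1)))
    (h : ∀ k : Fin (m + 1), |(w k.succ : ℤ) - (w k.castSucc : ℤ)| ≤ 1) :
    (∏ k : Fin (m + 1), X (reverseRotate w k.castSucc, reverseRotate w k.succ) :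
        MvPolynomial (Fin n × Fin n) ℤ) =
      ∏ k : Fin (m + 1), X (w k.castSucc, w k.succ) := by
  let g (a b : ℕ) : MvPolynomial (Fin n × Fin n) ℤ :=
    if hab : a < n ∧ b < n then X (⟨a, hab.1⟩, ⟨b, hab.2⟩) else 1
  have hg (a b : ℕ) : g a b ≠ 0 := by
    dsimp only [g]
    split_ifs
    · exact X_ne_zero _
    · exact one_ne_zero
  have hgX (a b : Fin n) : g a b = X (a, b) := by simp [g]
  have key := prod_closed_walk_eq_prod_reverse g hg (m + 1) (fun k => w k) h (congrArg _ hw)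
  simp only [hgX] at key
  exact (prod_reverseRotate (fun a b => X (a, b)) w hw).trans key.symm

open MvPolynomial in
theorem weight_preserving_bijection_exists (n : ℕ) (hn : 2 ≤ n)
    (i i' : Fin n) (hii' : (i' : ℕ) = (i : ℕ) + 1)
    (m : ℕ) (hm : 0 < m)
    (continuous : (Fin (m + 2) → Fin n) → Prop)
    (hcontinuous : ∀ w, continuous w ↔
      ∀ k : Fin (m + 1), |(w k.succ : ℤ) - (w k.castSucc : ℤ)| ≤ 1)
    (weight : (Fin (m + 2) → Fin n) → MvPolynomial (Fin n × Fin n) ℤ)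
    (hweight : ∀ w, weight w = ∏ k : Fin (m + 1), X (w k.castSucc, w k.succ))
    (S₁ S₂ : Set (Fin (m + 2) → Fin n))
    (hS₁ : S₁ = {w | continuous w ∧ w 0 = i ∧ w 1 = i' ∧ w (Fin.last (m + 1)) = i})
    (hS₂ : S₂ = {w | continuous w ∧ w 0 = i' ∧ w 1 = i ∧ w (Fin.last (m + 1)) = i'}) :
    ∃ T : S₁ ≃ S₂, ∀ w : S₁, weight (T w : Fin (m + 2) → Fin n) = weight (w : Fin (m + 2) → Fin n) := by
  have hmaps (a b : Fin n) (w : Fin (m + 2) → Fin n)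
      (h : continuous w ∧ w 0 = a ∧ w 1 = b ∧ w (Fin.last (m + 1)) = a) :
      continuous (reverseRotate w) ∧ reverseRotate w 0 = b ∧ reverseRotate w 1 = a ∧
        reverseRotate w (Fin.last (m + 1)) = b := by
    obtain ⟨hc, h0, h1, hl⟩ := h
    refine ⟨(hcontinuous _).2 (abs_step_reverseRotate_le_one w (h0.trans hl.symm)
      ((hcontinuous w).1 hc)), ?_, ?_, ?_⟩
    · rw [reverseRotate_zero, h1]
    · rw [reverseRotate_one, hl]
    · rw [reverseRotate_last, h1]
  subst hS₁ hS₂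
  refine ⟨⟨fun w => ⟨reverseRotate w.1, hmaps i i' w.1 w.2⟩,
    fun w => ⟨reverseRotate w.1, hmaps i' i w.1 w.2⟩, fun w => Subtype.ext ?_,
    fun w => Subtype.ext ?_⟩, fun w => ?_⟩
  · exact reverseRotate_reverseRotate w.1 (w.2.2.1.trans w.2.2.2.2.symm)
  · exact reverseRotate_reverseRotate w.1 (w.2.2.1.trans w.2.2.2.2.symm)
  · rw [hweight, hweight]
    exact prod_X_reverseRotate w.1 (w.2.2.1.trans w.2.2.2.2.symm) ((hcontinuous w.1).1 w.2.1)
end
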